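/- arXiv:1602.05100 — 3 statements merged into one kernel-verified Lean document; each statement's English description precedes it below -/
import Mathlib

section
/- For every integer n > 1, every integer k ≥ 1, and every deterministic adaptive querying strategy that issues fewer than n/k range queries and then outputs a real number, there exists a database D consisting of n distinct real numbers in the open interval (v₀, v∞), together with a sequence of valid top-k answers to the strategy's queries (each query being determined by the strategy from the previously received answers), such that the strategy's output is not equal to the minimum element of D. In other words, finding the smallest value of an n-element database through a top-k range-query interface with an adversarially chosen (arbitrary, unknown) system ranking function requires at least n/k queries in the worst case. -/
/-- A deterministic adaptive querying strategy: from the history of previously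
received top-`k` answers it determines the next range query `(a, b)`, and from the
full history of answers it outputs a real number, its claimed minimum of the
database. -/
structure RerankStrategy where
  query : List (Finset ℝ) → ℝ × ℝ
  output : List (Finset ℝ) → ℝ

/-- `ValidTopKAnswer k D q T`: `T` is a valid top-`k` answer to the range query
`q = (a, b)` with respect to the database `D`, i.e. `T ⊆ D ∩ (a, b)`,
`T = D ∩ (a, b)` whenever `|D ∩ (a, b)| ≤ k`, and `|T| = k` whenever
`|D ∩ (a, b)| > k` (which `k` elements are returned is arbitrary, modeling an
unknown proprietary system ranking function). -/
def ValidTopKAnswer (k : ℕ) (D : Finset ℝ) (q : ℝ × ℝ) (T : Finset ℝ) : Prop :=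
  T ⊆ D.filter (fun v => q.1 < v ∧ v < q.2) ∧
  ((D.filter (fun v => q.1 < v ∧ v < q.2)).card ≤ k →
      T = D.filter (fun v => q.1 < v ∧ v < q.2)) ∧
  (k < (D.filter (fun v => q.1 < v ∧ v < q.2)).card → T.card = k)

/-- The history of answers received after the first `i` queries. -/
def answerHistory (ans : ℕ → Finset ℝ) (i : ℕ) : List (Finset ℝ) :=
  List.ofFn fun j : Fin i => ans j

/-- Any `k` database elements inside the queried range form a valid top-`k` answer. -/
theorem ValidTopKAnswer.of_card_eq {k : ℕ} {D T : Finset ℝ} {q : ℝ × ℝ}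
    (hsub : T ⊆ D.filter (fun v => q.1 < v ∧ v < q.2)) (hcard : T.card = k) :
    ValidTopKAnswer k D q T :=
  ⟨hsub, fun h => Finset.eq_of_subset_of_card_le hsub (h.trans_eq hcard.symm), fun _ => hcard⟩

/-- A nonempty open interval of reals contains finite sets of every cardinality. -/
theorem exists_finset_card_eq_subset_Ioo {a b : ℝ} (hab : a < b) (m : ℕ) :
    ∃ T : Finset ℝ, T.card = m ∧ ∀ x ∈ T, x ∈ Set.Ioo a b := by
  obtain ⟨T, hsub, hcard⟩ := (Set.Ioo_infinite hab).exists_subset_card_eq m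
  exact ⟨T, hcard, fun x hx => hsub hx⟩

/-- The answer sequence generated by a responder that maps histories to answers. -/
theorem exists_answers_of_responder (f : List (Finset ℝ) → Finset ℝ) :
    ∃ ans : ℕ → Finset ℝ, ∀ i, ans i = f (answerHistory ans i) := by
  let hist : ℕ → List (Finset ℝ) := fun i => Nat.rec [] (fun _ l => l ++ [f l]) i
  have hhist : ∀ i, answerHistory (fun j => f (hist j)) i = hist i := by
    intro i
    induction i with
    | zero => rfl
    | succ i ih =>
      simp only [answerHistory] at ih
      simp only [answerHistory, List.ofFn_succ', Fin.val_castSucc, Fin.val_last, ih,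
        List.concat_eq_append]
      rfl
  exact ⟨fun j => f (hist j), fun i => by rw [hhist]⟩

/-- A finite subset of an open interval with fewer than `n` elements extends to an
`n`-element subset of the interval whose minimum avoids a prescribed value. -/
theorem exists_superset_card_eq_min'_ne {a b : ℝ} (hab : a < b) {n : ℕ} {U : Finset ℝ}
    (hU : ∀ x ∈ U, x ∈ Set.Ioo a b) (hcard : U.card < n) (y : ℝ) :
    ∃ (D : Finset ℝ) (hD : D.Nonempty),
      U ⊆ D ∧ D.card = n ∧ (∀ x ∈ D, x ∈ Set.Ioo a b) ∧ y ≠ D.min' hD := by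
  obtain ⟨c, hac, hcb, hcU⟩ : ∃ c, a < c ∧ c ≤ b ∧ ∀ x ∈ U, c ≤ x := by
    have hne : (insert b U).Nonempty := Finset.insert_nonempty b U
    refine ⟨(insert b U).min' hne, ?_, Finset.min'_le _ _ (Finset.mem_insert_self b U),
      fun x hx => Finset.min'_le _ _ (Finset.mem_insert_of_mem hx)⟩
    rw [Finset.lt_min'_iff]
    intro x hx
    rcases Finset.mem_insert.mp hx with rfl | hx
    · exact hab
    · exact (hU x hx).1
  obtain ⟨x, ⟨hax, hxc⟩, hxy⟩ := (Set.Ioo_infinite hac).exists_notMem_finset {y}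
  obtain ⟨E, hEcard, hE⟩ := exists_finset_card_eq_subset_Ioo hxc (n - 1 - U.card)
  have hlt : ∀ z ∈ E ∪ U, x < z := by
    intro z hz
    rcases Finset.mem_union.mp hz with hz | hz
    · exact (hE z hz).1
    · exact hxc.trans_le (hcU z hz)
  have hdisj : Disjoint E U :=
    Finset.disjoint_left.mpr fun z hzE hzU => (hE z hzE).2.not_ge (hcU z hzU)
  refine ⟨insert x (E ∪ U), Finset.insert_nonempty _ _,
    Finset.subset_union_right.trans (Finset.subset_insert _ _), ?_, ?_, ?_⟩
  · rw [Finset.card_insert_of_notMem fun h => (hlt x h).false,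
      Finset.card_union_of_disjoint hdisj]
    omega
  · intro z hz
    rcases Finset.mem_insert.mp hz with rfl | hz
    · exact ⟨hax, hxc.trans_le hcb⟩
    · refine ⟨hax.trans (hlt z hz), ?_⟩
      rcases Finset.mem_union.mp hz with hz | hz
      · exact (hE z hz).2.trans_le hcb
      · exact (hU z hz).2
  · have hmin : (insert x (E ∪ U)).min' (Finset.insert_nonempty _ _) = x := by
      refine le_antisymm (Finset.min'_le _ _ (Finset.mem_insert_self _ _))
        (Finset.le_min' _ _ _ fun z hz => ?_)
      rcases Finset.mem_insert.mp hz with rfl | hz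
      · exact le_rfl
      · exact (hlt z hz).le
    rw [hmin]
    exact fun h => hxy (Finset.mem_singleton.mpr h.symm)

/-- For every `n > 1`, `k ≥ 1`, and every deterministic adaptive
strategy issuing `qn < n / k` range queries `(a, b)` with `v₀ ≤ a < b ≤ vTop` before
outputting a number, there is a database `D` of `n` distinct reals in `(v₀, vTop)`
and a sequence of valid top-`k` answers (each query determined by the strategy from
the previous answers) for which the strategy's output is not the minimum of `D`:
finding the smallest value through a top-`k` range-query interface with an
adversarial system ranking function requires at least `n / k` queries. -/
theorem reranking_lower_bound
    (v₀ vTop : ℝ) (hv : v₀ < vTop)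
    (n k qn : ℕ) (hn : 1 < n) (hk : 1 ≤ k)
    (strat : RerankStrategy)
    (hvalidq : ∀ hist : List (Finset ℝ),
      v₀ ≤ (strat.query hist).1 ∧ (strat.query hist).1 < (strat.query hist).2 ∧
        (strat.query hist).2 ≤ vTop)
    (hq : (qn : ℝ) < (n : ℝ) / (k : ℝ)) :
    ∃ (D : Finset ℝ) (hD : D.Nonempty) (ans : ℕ → Finset ℝ),
      D.card = n ∧ (↑D : Set ℝ) ⊆ Set.Ioo v₀ vTop ∧
      (∀ i, i < qn → ValidTopKAnswer k D (strat.query (answerHistory ans i)) (ans i)) ∧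
      strat.output (answerHistory ans qn) ≠ D.min' hD := by
  choose f hfcard hf using fun hist : List (Finset ℝ) =>
    exists_finset_card_eq_subset_Ioo (hvalidq hist).2.1 k
  obtain ⟨ans, hans⟩ := exists_answers_of_responder f
  have hanscard : ∀ i, (ans i).card = k := fun i => hans i ▸ hfcard _
  have hmem : ∀ i, ∀ x ∈ ans i, x ∈ Set.Ioo (strat.query (answerHistory ans i)).1
      (strat.query (answerHistory ans i)).2 := fun i x hx => hf _ x (hans i ▸ hx)
  have hU : ∀ x ∈ (Finset.range qn).biUnion ans, x ∈ Set.Ioo v₀ vTop := by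
    intro x hx
    obtain ⟨i, -, hi⟩ := Finset.mem_biUnion.mp hx
    obtain ⟨hlo, -, hhi⟩ := hvalidq (answerHistory ans i)
    exact Set.Ioo_subset_Ioo hlo hhi (hmem i x hi)
  have hlt : qn * k < n := by
    rw [lt_div_iff₀ (by exact_mod_cast hk)] at hq
    exact_mod_cast hq
  have hUcard : ((Finset.range qn).biUnion ans).card < n := by
    refine lt_of_le_of_lt (Finset.card_biUnion_le_card_mul _ _ k fun i _ => (hanscard i).le) ?_
    rwa [Finset.card_range]
  obtain ⟨D, hD, hUD, hDcard, hDmem, hDmin⟩ :=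
    exists_superset_card_eq_min'_ne hv hU hUcard (strat.output (answerHistory ans qn))
  refine ⟨D, hD, ans, hDcard, fun x hx => hDmem x hx, fun i hi => ?_, hDmin⟩
  refine ValidTopKAnswer.of_card_eq (fun x hx => Finset.mem_filter.mpr ⟨hUD ?_, hmem i x hx⟩)
    (hanscard i)
  exact Finset.mem_biUnion.mpr ⟨i, Finset.mem_range.mpr hi, hx⟩
end

section
/- Let S : ℝ^m → ℝ be a monotone ranking function, let t ∈ [0, ∞)^m, and let ℓ ∈ ℝ^m satisfy both t_i ≤ ℓ_i and S(ℓ_i · e_i) ≥ S(t) for every coordinate i, where ℓ_i · e_i denotes the vector whose i-th coordinate is ℓ_i and whose other coordinates are 0. Define Q_j = {x ∈ ℝ^m : t_i ≤ x_i < ℓ_i for all i < j, x_j < t_j, and x_i < ℓ_i for all i > j} for j = 1, …, m. Then every x ∈ [0, ∞)^m with S(x) < S(t) belongs to exactly one of the sets Q₁, …, Q_m. -/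
/-- The `j`-th conjunctive range query issued by MD-BASELINE around the reference
tuple `t` with per-coordinate upper bounds `ℓ`. -/
def mdBaselineQuery {m : ℕ} (t ℓ : Fin m → ℝ) (j : Fin m) : Set (Fin m → ℝ) :=
  {x | (∀ i, i < j → t i ≤ x i ∧ x i < ℓ i) ∧ x j < t j ∧ ∀ i, j < i → x i < ℓ i}

/-- If `S` is monotone, `t` lies in the nonnegative orthant, and the
axis intercepts `ℓ` satisfy `t i ≤ ℓ i` and `S (ℓ i • e_i) ≥ S t` for all `i`, then
every nonnegative `x` outranking `t` (i.e. with `S x < S t`) belongs to exactly one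
of the MD-BASELINE queries `Q₁, …, Q_m`. -/
theorem md_baseline_queries_cover_outranking
    (m : ℕ) (S : (Fin m → ℝ) → ℝ) (hS : Monotone S)
    (t : Fin m → ℝ) (ht : ∀ i, 0 ≤ t i)
    (ℓ : Fin m → ℝ) (htℓ : ∀ i, t i ≤ ℓ i)
    (hℓ : ∀ i, S t ≤ S (Pi.single i (ℓ i)))
    (x : Fin m → ℝ) (hx : ∀ i, 0 ≤ x i) (hxt : S x < S t) :
    ∃! j : Fin m, x ∈ mdBaselineQuery t ℓ j := by
  have hlt : ∀ i, x i < ℓ i := fun i => by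
    by_contra! h
    refine absurd ((hℓ i).trans (hS fun k => ?_)) hxt.not_ge
    obtain rfl | hk := eq_or_ne k i
    · simpa using h
    · simpa [Pi.single_eq_of_ne hk] using hx k
  have hex : ∃ j, x j < t j := by
    by_contra! h
    exact hxt.not_ge (hS h)
  obtain ⟨j, hj, hmin⟩ := WellFounded.has_min (wellFounded_lt (α := Fin m)) {j | x j < t j} hex
  refine ⟨j, ⟨fun i hi => ⟨not_lt.1 fun h => hmin i h hi, hlt i⟩, hj, fun i _ => hlt i⟩, ?_⟩
  rintro k ⟨hk, hkt, -⟩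
  exact le_antisymm (not_lt.1 fun h => (hk j h).1.not_gt hj) (not_lt.1 (hmin k hkt))
end

section
/- Let x₁ < x₂ < ⋯ < x_n be real numbers, let δ > 0, let s ≥ 1 be an integer, and let h ∈ {1, …, n}. Suppose there exists an interval [a, b] with b − a < δ that contains x_h and contains at least s + 1 of the values x₁, …, x_n. Then there exists an index j with h − s ≤ j ≤ h, 1 ≤ j, and j + s ≤ n, such that x_{j+s} − x_j < δ. -/
/-- If `x₁ < ⋯ < x_n` (indices `1, …, n`), `δ > 0`, `s ≥ 1`, and some
interval `[a, b]` of width less than `δ` contains `x_h` together with at least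
`s + 1` of the values, then some window of `s + 1` consecutive sorted values around
rank `h` has width less than `δ`: there is `j` with `h - s ≤ j ≤ h`, `1 ≤ j`,
`j + s ≤ n`, and `x_{j+s} - x_j < δ`. -/
theorem dense_region_window
    (n : ℕ) (x : ℕ → ℝ)
    (hmono : ∀ i j : ℕ, 1 ≤ i → i < j → j ≤ n → x i < x j)
    (δ : ℝ) (hδ : 0 < δ) (s : ℕ) (hs : 1 ≤ s)
    (h : ℕ) (hh1 : 1 ≤ h) (hhn : h ≤ n)
    (a b : ℝ) (hab : b - a < δ)
    (hmem : x h ∈ Set.Icc a b)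
    (hdense : s + 1 ≤ ((Finset.Icc 1 n).filter fun i => x i ∈ Set.Icc a b).card) :
    ∃ j : ℕ, h - s ≤ j ∧ j ≤ h ∧ 1 ≤ j ∧ j + s ≤ n ∧ x (j + s) - x j < δ := by
  have mono : ∀ i j : ℕ, 1 ≤ i → i ≤ j → j ≤ n → x i ≤ x j := by
    intro i j hi hij hj
    rcases hij.eq_or_lt with rfl | hlt
    · exact le_rfl
    · exact (hmono i j hi hlt hj).le
  set F := (Finset.Icc 1 n).filter fun i => x i ∈ Set.Icc a b
  have hhF : h ∈ F := Finset.mem_filter.2 ⟨Finset.mem_Icc.2 ⟨hh1, hhn⟩, hmem⟩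
  have hne : F.Nonempty := ⟨h, hhF⟩
  obtain ⟨hp, hpx⟩ := Finset.mem_filter.1 (F.min'_mem hne)
  obtain ⟨hq, hqx⟩ := Finset.mem_filter.1 (F.max'_mem hne)
  have hph := F.min'_le h hhF
  have hhq := F.le_max' h hhF
  have hcard : F.card ≤ (Finset.Icc (F.min' hne) (F.max' hne)).card :=
    Finset.card_le_card fun i hi => Finset.mem_Icc.2 ⟨F.min'_le i hi, F.le_max' i hi⟩
  rw [Nat.card_Icc] at hcard
  rw [Finset.mem_Icc] at hp hq
  generalize F.min' hne = p at *
  generalize F.max' hne = q at *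
  have hjq : max p (h - s) + s ≤ q := by omega
  refine ⟨max p (h - s), le_max_right _ _, by omega, by omega, by omega, ?_⟩
  have h₁ : x p ≤ x (max p (h - s)) := mono _ _ hp.1 (le_max_left _ _) (by omega)
  have h₂ : x (max p (h - s) + s) ≤ x q := mono _ _ (by omega) hjq hq.2
  linarith [hpx.1, hqx.2]
end
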